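/- Let M = S³ × ℝ³, where S³ is the unit sphere in ℝ⁴. Let N be any topological space, b ∈ M, r ∈ N, f : M → N a function, and φ : M × M × N → M × M × N a continuous map with φ(x, b, r) = (x, x, f x) for all x ∈ M. Then φ is not homotopic to the identity map of M × M × N. -/

import Mathlib

open Set Metric Polynomial in
theorem det_interp (v : Fin 5 → ℝ) (hv : Function.Injective v) :
    ∃ w : Fin 5 → ℝ, ∑ i, w i = 1 ∧
      ∀ L : EuclideanSpace ℝ (Fin 4) →L[ℝ] EuclideanSpace ℝ (Fin 4),
      (1 + L).det = ∑ i, w i * (1 + v i • L).det := by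
  classical
  refine ⟨fun i => (Lagrange.basis Finset.univ v i).eval 1, ?_, ?_⟩
  · rw [← Polynomial.eval_finsetSum, Lagrange.sum_basis hv.injOn Finset.univ_nonempty]
    simp
  · intro L
    let b := (EuclideanSpace.basisFun (Fin 4) ℝ).toBasis
    let A : Matrix (Fin 4) (Fin 4) ℝ := LinearMap.toMatrix b b (L : _ →ₗ[ℝ] _)
    let p : ℝ[X] := Matrix.det ((X : ℝ[X]) • A.map C + (1 : Matrix (Fin 4) (Fin 4) ℝ).map C)
    have hp : p.degree < (Finset.univ : Finset (Fin 5)).card := by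
      refine lt_of_le_of_lt Polynomial.degree_le_natDegree ?_
      have := Polynomial.natDegree_det_X_add_C_le A 1
      simp only [Fintype.card_fin] at this
      simp only [Finset.card_univ, Fintype.card_fin]
      exact_mod_cast Nat.lt_succ_of_le this
    have hev : ∀ t : ℝ, p.eval t = (1 + t • L).det := by
      intro t
      have h1 : (1 + t • L).det = Matrix.det (t • A + 1) := by
        rw [ContinuousLinearMap.det, ← LinearMap.det_toMatrix b]
        congr 1
        simp [A, map_add, add_comm, LinearMap.toMatrix_one]
      rw [h1, ← Polynomial.coe_evalRingHom, RingHom.map_det]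
      congr 1
      ext i j
      rcases eq_or_ne i j with hij | hij
      · subst hij
        simp
        try ring
      · simp [Matrix.one_apply_ne hij]
        try ring
    have := Lagrange.eq_interpolate hv.injOn hp
    have h2 := congrArg (Polynomial.eval 1) this
    rw [hev, Lagrange.interpolate_apply, Polynomial.eval_finsetSum] at h2
    simp only [one_smul, Polynomial.eval_mul, Polynomial.eval_C, hev] at h2
    rw [h2]
    exact Finset.sum_congr rfl fun i _ => mul_comm _ _

/-- Extension by zero of a map vanishing on the sphere stays Lipschitz. -/
theorem glue_lipschitz {K : NNReal} (g : EuclideanSpace ℝ (Fin 4) → EuclideanSpace ℝ (Fin 4))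
    (hg : LipschitzOnWith K g (Metric.closedBall 0 2))
    (h0 : ∀ x, ‖x‖ = 2 → g x = 0) :
    LipschitzWith K (fun x => if ‖x‖ ≤ 2 then g x else 0) := by
  have key : ∀ x y : EuclideanSpace ℝ (Fin 4), ‖x‖ ≤ 2 → ¬ ‖y‖ ≤ 2 → dist (g x) 0 ≤ K * dist x y := by
    intro x y hx hy
    push Not at hy
    have hc : ContinuousOn (fun t : ℝ => ‖AffineMap.lineMap x y t‖) (Set.Icc 0 1) := by
      have : Continuous (fun t : ℝ => (AffineMap.lineMap x y t : EuclideanSpace ℝ (Fin 4))) :=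
        AffineMap.lineMap_continuous
      exact this.norm.continuousOn
    have := intermediate_value_Icc (zero_le_one) hc
    obtain ⟨t, ht, hz⟩ := this (show (2:ℝ) ∈ _ by simp [hx, hy.le])
    simp only at hz
    rw [← h0 _ hz]
    refine (hg.dist_le_mul x (by simpa using hx) _ (by simp [hz])).trans ?_
    gcongr
    rw [dist_left_lineMap, Real.norm_eq_abs, abs_of_nonneg ht.1]
    exact mul_le_of_le_one_left dist_nonneg ht.2
  refine LipschitzWith.of_dist_le_mul fun x y => ?_
  by_cases hx : ‖x‖ ≤ 2 <;> by_cases hy : ‖y‖ ≤ 2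
  · simp only [hx, hy, if_true]
    exact hg.dist_le_mul x (by simpa using hx) y (by simpa using hy)
  · simp only [hx, hy, if_true, if_false]
    exact key x y hx hy
  · simp only [hx, hy, if_true, if_false]
    rw [dist_comm, dist_comm x]
    exact key y x hy hx
  · simp only [hx, hy, if_false, dist_self]
    positivity

open MeasureTheory in
theorem vol_small {K : NNReal} (g : EuclideanSpace ℝ (Fin 4) → EuclideanSpace ℝ (Fin 4))
    (hd : ContDiff ℝ 1 g)
    (hg : LipschitzOnWith K g (Metric.closedBall 0 2))
    (h0 : ∀ x, ‖x‖ = 2 → g x = 0) (t : ℝ) (ht : 0 ≤ t) (htK : t * K < 1) :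
    ∫ x in Metric.ball (0 : EuclideanSpace ℝ (Fin 4)) 2, (1 + t • fderiv ℝ g x).det
      = volume.real (Metric.ball (0 : EuclideanSpace ℝ (Fin 4)) 2) := by
  set B := Metric.ball (0 : EuclideanSpace ℝ (Fin 4)) 2 with hB
  let h : EuclideanSpace ℝ (Fin 4) → EuclideanSpace ℝ (Fin 4) :=
    fun x => if ‖x‖ ≤ 2 then g x else 0
  have hl : LipschitzWith K h := glue_lipschitz g hg h0
  let f : EuclideanSpace ℝ (Fin 4) → EuclideanSpace ℝ (Fin 4) := fun x => x + t • h x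
  have happ : ApproximatesLinearOn f
      ((ContinuousLinearEquiv.refl ℝ (EuclideanSpace ℝ (Fin 4)) : _ ≃L[ℝ] _) : _ →L[ℝ] _)
      Set.univ (t.toNNReal * K) := by
    intro x _ y _
    have : f x - f y - (x - y) = t • (h x - h y) := by simp only [f, smul_sub]; abel
    simp only [ContinuousLinearEquiv.coe_coe, ContinuousLinearEquiv.refl_apply]
    rw [this, norm_smul, Real.norm_eq_abs, abs_of_nonneg ht]
    have := hl.dist_le_mul x y
    rw [dist_eq_norm, dist_eq_norm] at this
    rw [NNReal.coe_mul, Real.coe_toNNReal t ht, mul_assoc]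
    exact mul_le_mul_of_nonneg_left this ht
  have hc : Subsingleton (EuclideanSpace ℝ (Fin 4)) ∨ (t.toNNReal * K : NNReal) <
      ‖(((ContinuousLinearEquiv.refl ℝ (EuclideanSpace ℝ (Fin 4))).symm : _ ≃L[ℝ] _) :
        EuclideanSpace ℝ (Fin 4) →L[ℝ] EuclideanSpace ℝ (Fin 4))‖₊⁻¹ := by
    right
    have : ‖(((ContinuousLinearEquiv.refl ℝ (EuclideanSpace ℝ (Fin 4))).symm : _ ≃L[ℝ] _) :
        EuclideanSpace ℝ (Fin 4) →L[ℝ] EuclideanSpace ℝ (Fin 4))‖₊ = 1 := by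
      apply NNReal.eq
      exact ContinuousLinearMap.norm_id
    rw [this, inv_one, ← NNReal.coe_lt_coe, NNReal.coe_mul, Real.coe_toNNReal t ht]
    exact htK
  have hinj : Function.Injective f := Set.injOn_univ.1 (happ.injOn hc)
  have hsurj : Function.Surjective f := happ.surjective hc
  have hout : ∀ x, x ∉ B → f x = x := by
    intro x hx
    have hx' : 2 ≤ ‖x‖ := by simpa [hB] using hx
    have : h x = 0 := by
      simp only [h]
      split_ifs with h2
      · exact h0 x (le_antisymm h2 hx')
      · rfl
    simp [f, this]
  have himg : Set.image f B = B := by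
    have : Set.image f Bᶜ = Bᶜ := by
      have h1 : Set.image f Bᶜ = Set.image id Bᶜ := Set.image_congr fun x hx => hout x hx
      rw [h1, Set.image_id]
    have h2 := Set.image_compl_eq (s := B) ⟨hinj, hsurj⟩
    rw [this] at h2
    exact (compl_injective h2).symm
  have hder : ∀ x ∈ B, HasFDerivWithinAt f (1 + t • fderiv ℝ g x) B x := by
    intro x hx
    have h1 : HasFDerivAt g (fderiv ℝ g x) x := (hd.differentiable one_ne_zero x).hasFDerivAt
    have h2 : HasFDerivAt (fun x => x + t • g x) (1 + t • fderiv ℝ g x) x :=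
      (hasFDerivAt_id x).add (h1.const_smul t)
    refine h2.hasFDerivWithinAt.congr (fun y hy => ?_) ?_
    · have : ‖y‖ ≤ 2 := by simp [hB] at hy; exact hy.le
      simp [f, h, this]
    · have : ‖x‖ ≤ 2 := by simp [hB] at hx; exact hx.le
      simp [f, h, this]
  have hpos : ∀ x ∈ B, 0 ≤ (1 + t • fderiv ℝ g x).det := by
    intro x hx
    have hn : ‖fderiv ℝ g x‖ ≤ K := norm_fderiv_le_of_lipschitzOn ℝ
      (Metric.closedBall_mem_nhds_of_mem hx) hg
    by_contra hneg
    push Not at hneg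
    have hcont : ContinuousOn (fun s : ℝ => (1 + s • fderiv ℝ g x).det) (Set.Icc 0 t) := by
      apply Continuous.continuousOn
      exact ContinuousLinearMap.continuous_det.comp (by fun_prop)
    obtain ⟨s, hs, hz⟩ := intermediate_value_Icc' ht hcont (show (0:ℝ) ∈ _ by
      refine ⟨hneg.le, ?_⟩
      have e : 1 + (0:ℝ) • fderiv ℝ g x = 1 := ContinuousLinearMap.ext fun v => by simp
      change (0:ℝ) ≤ (1 + (0:ℝ) • fderiv ℝ g x).det
      rw [e]
      have : (1 : EuclideanSpace ℝ (Fin 4) →L[ℝ] EuclideanSpace ℝ (Fin 4)).det = 1 :=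
        LinearMap.det_id
      rw [this]; exact zero_le_one)
    simp only at hz
    have hbot := LinearMap.bot_lt_ker_of_det_eq_zero hz
    obtain ⟨v, hv, hv0⟩ := (Submodule.ne_bot_iff _).1 hbot.ne'
    have hv' : v + s • fderiv ℝ g x v = 0 := by simpa using hv
    have : ‖v‖ ≤ s * K * ‖v‖ := by
      calc ‖v‖ = ‖s • fderiv ℝ g x v‖ := by
            rw [← norm_neg v, neg_eq_of_add_eq_zero_right hv']
        _ = s * ‖fderiv ℝ g x v‖ := by rw [norm_smul, Real.norm_eq_abs, abs_of_nonneg hs.1]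
        _ ≤ s * (K * ‖v‖) := by
            apply mul_le_mul_of_nonneg_left _ hs.1
            exact (ContinuousLinearMap.le_opNorm _ _).trans (by gcongr)
        _ = _ := by ring
    have h3 : s * K ≤ t * K := by gcongr; exact hs.2
    have h4 : 0 < ‖v‖ := norm_pos_iff.2 hv0
    nlinarith
  have hcv := integral_image_eq_integral_abs_det_fderiv_smul volume
    (Metric.isOpen_ball.measurableSet : MeasurableSet B) hder hinj.injOn (fun _ => (1:ℝ))
  rw [himg] at hcv
  simp only [smul_eq_mul, mul_one] at hcv
  rw [← setIntegral_congr_fun (Metric.isOpen_ball.measurableSet : MeasurableSet B)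
    (f := fun x => |(1 + t • fderiv ℝ g x).det|) (fun x hx => abs_of_nonneg (hpos x hx)), ← hcv]
  simp

open MeasureTheory in
theorem no_smooth_retraction (r : EuclideanSpace ℝ (Fin 4) → EuclideanSpace ℝ (Fin 4))
    (hr : ContDiff ℝ 1 r) (hn : ∀ x, ‖r x‖ = 2) (hs : ∀ x, ‖x‖ = 2 → r x = x) : False := by
  let g : EuclideanSpace ℝ (Fin 4) → EuclideanSpace ℝ (Fin 4) := fun x => r x - x
  have hg : ContDiff ℝ 1 g := hr.sub contDiff_id
  obtain ⟨K, hK⟩ : ∃ K, LipschitzOnWith K g (Metric.closedBall 0 2) :=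
    LocallyLipschitzOn.exists_lipschitzOnWith_of_compact (isCompact_closedBall _ _)
      hg.locallyLipschitz.locallyLipschitzOn
  have h0 : ∀ x, ‖x‖ = 2 → g x = 0 := fun x hx => by simp [g, hs x hx]
  let v : Fin 5 → ℝ := fun i => (i : ℝ) / (5 * (K + 1))
  have hKp : (0:ℝ) < 5 * (K + 1) := by positivity
  have hv : Function.Injective v := by
    intro i j hij
    simp only [v] at hij
    rw [div_left_inj' hKp.ne'] at hij
    exact Fin.ext (by exact_mod_cast hij)
  obtain ⟨w, hw, hdet⟩ := det_interp v hv
  have hvol : ∀ i, ∫ x in Metric.ball (0 : EuclideanSpace ℝ (Fin 4)) 2,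
      (1 + v i • fderiv ℝ g x).det
      = volume.real (Metric.ball (0 : EuclideanSpace ℝ (Fin 4)) 2) := by
    intro i
    refine vol_small g hg hK h0 (v i) (by positivity) ?_
    simp only [v]
    rw [div_mul_eq_mul_div, div_lt_one hKp]
    have : ((i : ℕ) : ℝ) ≤ 4 := by exact_mod_cast Nat.lt_succ_iff.1 i.2
    have hK0 : (0:ℝ) ≤ K := K.2
    nlinarith
  have hintegrable : ∀ i, IntegrableOn (fun x => w i * (1 + v i • fderiv ℝ g x).det)
      (Metric.ball (0 : EuclideanSpace ℝ (Fin 4)) 2) := by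
    intro i
    have hc : Continuous (fun x => w i * (1 + v i • fderiv ℝ g x).det) := by
      have h1 : Continuous (fderiv ℝ g) := hg.continuous_fderiv one_ne_zero
      exact continuous_const.mul (ContinuousLinearMap.continuous_det.comp (by fun_prop))
    exact (hc.continuousOn.integrableOn_compact (isCompact_closedBall _ 2)).mono_set
      Metric.ball_subset_closedBall
  have hzero : ∀ x, (1 + fderiv ℝ g x).det = 0 := by
    intro x
    have hrd : HasFDerivAt r (fderiv ℝ r x) x := (hr.differentiable one_ne_zero x).hasFDerivAt
    have : 1 + fderiv ℝ g x = fderiv ℝ r x := by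
      have h1 : HasFDerivAt g (fderiv ℝ r x - 1) x := hrd.sub (hasFDerivAt_id x)
      rw [h1.fderiv]; abel
    rw [this]
    by_contra hne
    have hsurj : Function.Surjective (fderiv ℝ r x) := by
      have hu : IsUnit (fderiv ℝ r x : EuclideanSpace ℝ (Fin 4) →ₗ[ℝ] EuclideanSpace ℝ (Fin 4)) :=
        (LinearMap.isUnit_iff_isUnit_det _).2 (isUnit_iff_ne_zero.2 hne)
      exact ((Module.End.isUnit_iff _).1 hu).2
    obtain ⟨u, hu⟩ := hsurj (r x)
    have h1 := hrd.norm_sq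
    have h2 : HasFDerivAt (fun y => ‖r y‖ ^ 2) (0 : EuclideanSpace ℝ (Fin 4) →L[ℝ] ℝ) x := by
      simp only [hn]
      exact hasFDerivAt_const _ _
    have h3 := congrArg (fun l => l u) (h1.unique h2)
    simp [hu, hn] at h3
  have hfin : (0:ℝ) = volume.real (Metric.ball (0 : EuclideanSpace ℝ (Fin 4)) 2) := by
    calc (0:ℝ) = ∫ x in Metric.ball (0 : EuclideanSpace ℝ (Fin 4)) 2, (1 + fderiv ℝ g x).det := by
          simp [hzero]
      _ = ∫ x in Metric.ball (0 : EuclideanSpace ℝ (Fin 4)) 2,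
            ∑ i, w i * (1 + v i • fderiv ℝ g x).det := by
          congr 1; ext x; exact hdet _
      _ = ∑ i, w i * volume.real (Metric.ball (0 : EuclideanSpace ℝ (Fin 4)) 2) := by
          rw [integral_finsetSum _ fun i _ => hintegrable i]
          refine Finset.sum_congr rfl fun i _ => ?_
          rw [integral_const_mul, hvol]
      _ = _ := by rw [← Finset.sum_mul, hw, one_mul]
  have hp : 0 < volume.real (Metric.ball (0 : EuclideanSpace ℝ (Fin 4)) 2) := by
    rw [measureReal_def]
    exact ENNReal.toReal_pos (Metric.measure_ball_pos _ _ (by norm_num)).ne' measure_ball_lt_top.ne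
  linarith

theorem no_cont_retraction (F : EuclideanSpace ℝ (Fin 4) → EuclideanSpace ℝ (Fin 4))
    (hF : Continuous F) (hn : ∀ x, 1 ≤ ‖F x‖) (hs : ∀ x, 1 ≤ ‖x‖ → F x = x) : False := by
  obtain ⟨G, hG, hd, he, -⟩ := hF.exists_contDiff_approx_and_eqOn 1 (ε := fun _ => 1/2)
    continuous_const (fun _ => by norm_num) (S := {x | 2 ≤ ‖x‖}) (U := {x | 1 < ‖x‖})
    (isClosed_le continuous_const continuous_norm)
    ((isOpen_lt continuous_const continuous_norm).mem_nhdsSet.2 fun x hx => by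
      simp only [Set.mem_ofPred_eq] at hx ⊢; linarith)
    (contDiffOn_id.congr fun x hx => hs x (le_of_lt hx))
  have hne : ∀ x, G x ≠ 0 := by
    intro x h0
    have := hd x
    rw [h0, dist_zero_left] at this
    linarith [hn x]
  have hG' : ContDiff ℝ 1 G := hG
  refine no_smooth_retraction (fun x => (2 * ‖G x‖⁻¹) • G x) ?_ ?_ ?_
  · exact (contDiff_const.mul ((hG'.norm ℝ hne).inv fun x => norm_ne_zero_iff.2 (hne x))).smul hG'
  · intro x
    rw [norm_smul, norm_mul, norm_inv, norm_norm, mul_assoc,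
      inv_mul_cancel₀ (norm_ne_zero_iff.2 (hne x))]
    norm_num
  · intro x hx
    have h1 : G x = x := by
      rw [he (show x ∈ {x | 2 ≤ ‖x‖} from hx.ge), hs x (by rw [hx]; norm_num)]
    simp only [h1, hx]
    norm_num

theorem sphere_not_contractible (c : Metric.sphere (0 : EuclideanSpace ℝ (Fin 4)) 1)
    (H : ContinuousMap.Homotopy
      (ContinuousMap.const (Metric.sphere (0 : EuclideanSpace ℝ (Fin 4)) 1) c)
      (ContinuousMap.id (Metric.sphere (0 : EuclideanSpace ℝ (Fin 4)) 1))) : False := by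
  classical
  let n : EuclideanSpace ℝ (Fin 4) → Metric.sphere (0 : EuclideanSpace ℝ (Fin 4)) 1 :=
    fun x => if h : x = 0 then c else ⟨‖x‖⁻¹ • x, by
      simp [norm_smul, inv_mul_cancel₀ (norm_ne_zero_iff.2 h)]⟩
  have hnv : ∀ x, x ≠ 0 → (n x : EuclideanSpace ℝ (Fin 4)) = ‖x‖⁻¹ • x := by
    intro x hx
    simp [n, hx]
  have hnc : ∀ x, x ≠ 0 → ContinuousAt n x := by
    intro x hx
    rw [Topology.IsInducing.subtypeVal.continuousAt_iff]
    have h1 : ContinuousAt (fun y : EuclideanSpace ℝ (Fin 4) => ‖y‖⁻¹ • y) x :=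
      (continuousAt_id.norm.inv₀ (norm_ne_zero_iff.2 hx)).smul continuousAt_id
    refine h1.congr ?_
    filter_upwards [isOpen_ne.mem_nhds hx] with y hy
    exact (hnv y hy).symm
  let τ : EuclideanSpace ℝ (Fin 4) → unitInterval :=
    fun x => Set.projIcc 0 1 zero_le_one (2 * ‖x‖ - 1)
  have hτ : Continuous τ := continuous_projIcc.comp (by fun_prop)
  refine no_cont_retraction
    (fun x => (max 1 ‖x‖) • (H (τ x, n x) : EuclideanSpace ℝ (Fin 4))) ?_ ?_ ?_
  · refine continuous_const.max continuous_norm |>.smul (continuous_subtype_val.comp ?_)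
    rw [continuous_iff_continuousAt]
    intro x
    by_cases hx : x = 0
    · have : (fun x => H (τ x, n x)) =ᶠ[nhds x] fun _ => c := by
        have hb : Metric.ball x (1/2) ∈ nhds x := Metric.ball_mem_nhds _ (by norm_num)
        filter_upwards [hb] with y hy
        have hy' : ‖y‖ < 1/2 := by simpa [hx] using hy
        have : τ y = 0 := Set.projIcc_of_le_left _ (by linarith)
        rw [this, H.apply_zero]
        rfl
      exact continuousAt_const.congr this.symm
    · exact H.continuous.continuousAt.comp (hτ.continuousAt.prodMk (hnc x hx))
  · intro x
    have : ‖(H (τ x, n x) : EuclideanSpace ℝ (Fin 4))‖ = 1 := by simp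
    rw [norm_smul, this, mul_one, Real.norm_eq_abs]
    exact (le_max_left _ _).trans (le_abs_self _)
  · intro x hx
    have hx0 : x ≠ 0 := by
      rintro rfl
      norm_num at hx
    have : τ x = 1 := Set.projIcc_of_right_le _ (by linarith)
    simp only [this, H.apply_one, ContinuousMap.id_apply, hnv x hx0, max_eq_right hx, smul_smul]
    rw [mul_inv_cancel₀ (norm_ne_zero_iff.2 hx0), one_smul]



/-- On `M = S³ × ℝ³` (the phase space `T*SU(2) = T*S³`), any continuous self-map of
`M × M × N` sending `(x, b, r)` to `(x, x, f x)` for all `x` is not homotopic to the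
identity. -/
theorem cloning_map_not_homotopic_to_id_on_TS3
    (N : Type) [TopologicalSpace N]
    (b : (Metric.sphere (0 : EuclideanSpace ℝ (Fin 4)) 1) × (EuclideanSpace ℝ (Fin 3)))
    (r : N)
    (f : (Metric.sphere (0 : EuclideanSpace ℝ (Fin 4)) 1) × (EuclideanSpace ℝ (Fin 3)) → N)
    (φ : C(((Metric.sphere (0 : EuclideanSpace ℝ (Fin 4)) 1) × (EuclideanSpace ℝ (Fin 3))) ×
             ((Metric.sphere (0 : EuclideanSpace ℝ (Fin 4)) 1) × (EuclideanSpace ℝ (Fin 3))) × N,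
           ((Metric.sphere (0 : EuclideanSpace ℝ (Fin 4)) 1) × (EuclideanSpace ℝ (Fin 3))) ×
             ((Metric.sphere (0 : EuclideanSpace ℝ (Fin 4)) 1) × (EuclideanSpace ℝ (Fin 3))) × N))
    (hclone : ∀ x : (Metric.sphere (0 : EuclideanSpace ℝ (Fin 4)) 1) × (EuclideanSpace ℝ (Fin 3)),
      φ (x, b, r) = (x, x, f x)) :
    ¬ φ.Homotopic (ContinuousMap.id _) := by
  rintro ⟨H⟩
  let G := H.symm
  refine sphere_not_contractible b.1
    { toFun := fun p => (G (p.1, ((p.2, 0), b, r))).2.1.1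
      continuous_toFun := by fun_prop
      map_zero_left := fun x => ?_
      map_one_left := fun x => ?_ }
  · simp [G]
  · simp only [G, ContinuousMap.Homotopy.apply_one, hclone, ContinuousMap.id_apply]
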